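/- Let ρ satisfy (H0) and have compact support (so Q_ρ ∈ L¹(ℝ^n)). Then for every u ∈ C_c^∞(ℝ^n) and every ξ ∈ ℝ^n, the Fourier transform of the nonlocal gradient satisfies 𝓕(D_ρ u)(ξ) = 2πi ξ 𝓕(Q_ρ)(ξ) 𝓕(u)(ξ), where the Fourier transform is 𝓕(f)(ξ) = ∫_{ℝ^n} f(x) e^{−2πi x·ξ} dx (applied componentwise to vector fields). -/

import Mathlib

open MeasureTheory Metric Set Matrix
open scoped ENNReal InnerProductSpace

noncomputable section

/-- Points of `ℝ^n` with the Euclidean norm. -/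
abbrev Eu (n : ℕ) := EuclideanSpace ℝ (Fin n)

/-- Hypothesis (H0): `ρ` is a nonnegative radial kernel (with radial representation `ρb`),
locally integrable, with `∫ min{1,|x|⁻¹} ρ(x) dx < ∞`, and bounded below away from zero
on a closed ball of some radius `ε > 0`. -/
def IsKernelH0 (n : ℕ) (ρ : Eu n → ℝ) (ρb : ℝ → ℝ) (ε : ℝ) : Prop :=
  (∀ x, 0 ≤ ρ x) ∧
  (∀ x : Eu n, x ≠ 0 → ρ x = ρb ‖x‖) ∧
  LocallyIntegrable ρ volume ∧
  Integrable (fun x : Eu n => min 1 ‖x‖⁻¹ * ρ x) volume ∧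
  0 < ε ∧
  ∃ c > (0 : ℝ), ∀ x ∈ closedBall (0 : Eu n) ε, x ≠ 0 → c ≤ ρ x

/-- The auxiliary function `f_ρ(r) = r^(n-2) ρ̄(r)`. -/
def fRho (n : ℕ) (ρb : ℝ → ℝ) (r : ℝ) : ℝ := r ^ ((n : ℝ) - 2) * ρb r

/-- Hypothesis (H1): `f_ρ` and `r ↦ r^ν f_ρ(r)` are decreasing on `(0, ε)` for some `ν > 0`. -/
def IsKernelH1 (n : ℕ) (ρb : ℝ → ℝ) (ε : ℝ) : Prop :=
  ∃ ν > (0 : ℝ), AntitoneOn (fRho n ρb) (Ioo 0 ε) ∧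
    AntitoneOn (fun r => r ^ ν * fRho n ρb r) (Ioo 0 ε)

/-- Hypothesis (H2): `f_ρ` is smooth away from the origin and its derivatives satisfy
`|f_ρ^{(k)}(r)| ≤ C(k) r^(-k) f_ρ(r)` on `(0, ε)`. -/
def IsKernelH2 (n : ℕ) (ρb : ℝ → ℝ) (ε : ℝ) : Prop :=
  ContDiffOn ℝ (⊤ : ℕ∞) (fRho n ρb) (Ioi 0) ∧
  ∀ k : ℕ, 0 < k → ∃ C > (0 : ℝ), ∀ r ∈ Ioo (0 : ℝ) ε,
    |iteratedDerivWithin k (fRho n ρb) (Ioi 0) r| ≤ C * r ^ (-(k : ℝ)) * fRho n ρb r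

/-- Hypothesis (H3): `r ↦ r^(n+s-1) ρ̄(r)` is almost decreasing on `(0, ε)` for some `s ∈ (0,1)`. -/
def IsKernelH3 (n : ℕ) (ρb : ℝ → ℝ) (ε : ℝ) : Prop :=
  ∃ s ∈ Ioo (0 : ℝ) 1, ∃ C > (0 : ℝ), ∀ r₁ ∈ Ioo (0 : ℝ) ε, ∀ r₂ ∈ Ioo (0 : ℝ) ε, r₁ ≤ r₂ →
    C * (r₂ ^ ((n : ℝ) + s - 1) * ρb r₂) ≤ r₁ ^ ((n : ℝ) + s - 1) * ρb r₁

/-- Hypothesis (H4): `r ↦ r^(n+t-1) ρ̄(r)` is almost increasing on `(0, ε)` for some `t ∈ (0,1)`. -/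
def IsKernelH4 (n : ℕ) (ρb : ℝ → ℝ) (ε : ℝ) : Prop :=
  ∃ t ∈ Ioo (0 : ℝ) 1, ∃ C > (0 : ℝ), ∀ r₁ ∈ Ioo (0 : ℝ) ε, ∀ r₂ ∈ Ioo (0 : ℝ) ε, r₁ ≤ r₂ →
    C * (r₁ ^ ((n : ℝ) + t - 1) * ρb r₁) ≤ r₂ ^ ((n : ℝ) + t - 1) * ρb r₂

variable {n : ℕ}

/-- Nonlocal gradient of a scalar field:
`D_ρ u(x) = ∫ ((u(x) - u(y))/|x-y|) ((x-y)/|x-y|) ρ(x-y) dy`. -/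
def nlGradS (ρ : Eu n → ℝ) (u : Eu n → ℝ) (x : Eu n) : Eu n :=
  ∫ y, ((u x - u y) * ρ (x - y) / ‖x - y‖ ^ 2) • (x - y)

/-- The (i,j) entry of the integrand of the nonlocal gradient of a vector field. -/
def nlGradMInt (ρ : Eu n → ℝ) (u : Eu n → Eu n) (x : Eu n) (i j : Fin n) : Eu n → ℝ :=
  fun y => (u x - u y) i * (x - y) j * ρ (x - y) / ‖x - y‖ ^ 2

/-- Nonlocal gradient of a vector field, as a matrix:
`D_ρ u(x) = ∫ ((u(x)-u(y))/|x-y|) ⊗ ((x-y)/|x-y|) ρ(x-y) dy`. -/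
def nlGradM (ρ : Eu n → ℝ) (u : Eu n → Eu n) (x : Eu n) : Matrix (Fin n) (Fin n) ℝ :=
  Matrix.of fun i j => ∫ y, nlGradMInt ρ u x i j y

/-- The integrand of the nonlocal divergence of a vector field. -/
def nlDivVInt (ρ : Eu n → ℝ) (u : Eu n → Eu n) (x : Eu n) : Eu n → ℝ :=
  fun y => ⟪u x - u y, x - y⟫_ℝ * ρ (x - y) / ‖x - y‖ ^ 2

/-- Nonlocal divergence of a vector field:
`div_ρ u(x) = ∫ ((u(x)-u(y))·(x-y)/|x-y|²) ρ(x-y) dy`. -/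
def nlDivV (ρ : Eu n → ℝ) (u : Eu n → Eu n) (x : Eu n) : ℝ :=
  ∫ y, nlDivVInt ρ u x y

/-- The i-th component of the integrand of the nonlocal divergence of a matrix field. -/
def nlDivMInt (ρ : Eu n → ℝ) (Φ : Eu n → Matrix (Fin n) (Fin n) ℝ) (x : Eu n) (i : Fin n) :
    Eu n → ℝ :=
  fun y => (∑ j, (Φ x i j - Φ y i j) * (x - y) j) * ρ (x - y) / ‖x - y‖ ^ 2

/-- Nonlocal divergence of a matrix field:
`div_ρ Φ(x) = ∫ ((Φ(x)-Φ(y))/|x-y|) ((x-y)/|x-y|) ρ(x-y) dy ∈ ℝ^n`. -/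
def nlDivM (ρ : Eu n → ℝ) (Φ : Eu n → Matrix (Fin n) (Fin n) ℝ) (x : Eu n) : Eu n :=
  (WithLp.equiv 2 (Fin n → ℝ)).symm fun i => ∫ y, nlDivMInt ρ Φ x i y

/-- Frobenius inner product `A : B = Σ_{ij} a_{ij} b_{ij}` of matrices. -/
def frobInner (A B : Matrix (Fin n) (Fin n) ℝ) : ℝ := ∑ i, ∑ j, A i j * B i j

/-- Symmetric part of a matrix, `M_sym = (M + Mᵀ)/2`. -/
def symPart (M : Matrix (Fin n) (Fin n) ℝ) : Matrix (Fin n) (Fin n) ℝ :=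
  (1 / 2 : ℝ) • (M + Mᵀ)

/-- The potential `Q_ρ(x) = ∫_{|x|}^∞ ρ̄(t)/t dt`. -/
def Qker (n : ℕ) (ρb : ℝ → ℝ) (x : Eu n) : ℝ := ∫ t in Ioi ‖x‖, ρb t / t

/-- Classical Jacobian matrix of a vector field, `(Du)_{ij} = ∂u_i/∂x_j`. -/
def jacobianM (u : Eu n → Eu n) (x : Eu n) : Matrix (Fin n) (Fin n) ℝ :=
  Matrix.of fun i j => fderiv ℝ (fun z => u z i) x (EuclideanSpace.single j 1)

/-- Rank-one matrix `a ⊗ b = (a_i b_j)`. -/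
def tensorP (a b : Eu n) : Matrix (Fin n) (Fin n) ℝ := Matrix.of fun i j => a i * b j

/-- Isotropic elasticity tensor `C[M] = 2μ M_sym + λ (tr M) I`. -/
def isoC (μ lam : ℝ) (M : Matrix (Fin n) (Fin n) ℝ) : Matrix (Fin n) (Fin n) ℝ :=
  (2 * μ) • symPart M + (lam * Matrix.trace M) • (1 : Matrix (Fin n) (Fin n) ℝ)

/-- Fourier transform `𝓕 f(ξ) = ∫ f(x) e^{-2πi x·ξ} dx` of a complex-valued function on ℝ^n. -/
def fInt (f : Eu n → ℂ) (ξ : Eu n) : ℂ :=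
  ∫ x, f x * Complex.exp (-(2 * Real.pi * (⟪x, ξ⟫_ℝ : ℝ) * Complex.I))

/-- The nonlocal Laplacian `(-Δ)_ρ v = -div_ρ (D_ρ v)` of a vector field. -/
def nlLap (ρ : Eu n → ℝ) (v : Eu n → Eu n) (x : Eu n) : Eu n :=
  -nlDivM ρ (fun z => nlGradM ρ v z) x

/-- The i-th component of the integrand of `K_{ρ,φ}(Φ)` from the nonlocal Leibniz rule. -/
def KtermInt (ρ : Eu n → ℝ) (φ : Eu n → ℝ) (Φ : Eu n → Matrix (Fin n) (Fin n) ℝ)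
    (x : Eu n) (i : Fin n) : Eu n → ℝ :=
  fun y => (φ x - φ y) * (∑ j, Φ y i j * (x - y) j) * ρ (x - y) / ‖x - y‖ ^ 2

/-- `K_{ρ,φ}(Φ)(x) = ∫ ((φ(x)-φ(y))/|x-y|) Φ(y) ((x-y)/|x-y|) ρ(x-y) dy`. -/
def Kterm (ρ : Eu n → ℝ) (φ : Eu n → ℝ) (Φ : Eu n → Matrix (Fin n) (Fin n) ℝ)
    (x : Eu n) : Eu n :=
  (WithLp.equiv 2 (Fin n → ℝ)).symm fun i => ∫ y, KtermInt ρ φ Φ x i y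

/-- Classical divergence of a vector field. -/
def divCl (w : Eu n → Eu n) (x : Eu n) : ℝ :=
  ∑ i, fderiv ℝ (fun z => w z i) x (EuclideanSpace.single i 1)

variable (n)

section Polar

variable {E F : Type*} [NormedAddCommGroup E] [NormedSpace ℝ E] [FiniteDimensional ℝ E]
  [MeasurableSpace E] [BorelSpace E] [NormedAddCommGroup F] [NormedSpace ℝ F]
  (μ : Measure E) [μ.IsAddHaarMeasure]

/-- Integrating against the tail integral of a function of the radius, via Fubini. -/
theorem integral_tail_smul [CompleteSpace F] {h : ℝ → ℝ} {q : E → F} {C : ℝ}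
    (hh : IntegrableOn (fun t : ℝ => t ^ Module.finrank ℝ E * h t) (Ioi 0))
    (hq : Continuous q) (hC : ∀ x, ‖q x‖ ≤ C) :
    IntegrableOn (fun t : ℝ => h t • ∫ x in ball (0 : E) t, q x ∂μ) (Ioi 0) ∧
    ∫ x, (∫ t in Ioi ‖x‖, h t) • q x ∂μ =
      ∫ t in Ioi (0 : ℝ), h t • ∫ x in ball (0 : E) t, q x ∂μ := by
  have hm : AEStronglyMeasurable h (volume.restrict (Ioi 0)) := by
    have h2 : AEStronglyMeasurable (fun t : ℝ => (t ^ Module.finrank ℝ E)⁻¹ *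
        (t ^ Module.finrank ℝ E * h t)) (volume.restrict (Ioi 0)) :=
      ((measurable_id.pow_const _).inv.aestronglyMeasurable).mul hh.aestronglyMeasurable
    refine h2.congr ?_
    filter_upwards [ae_restrict_mem measurableSet_Ioi] with t ht
    rw [inv_mul_cancel_left₀ (pow_ne_zero _ ht.out.ne')]
  set P : E × ℝ → F := {p : E × ℝ | ‖p.1‖ < p.2}.indicator (fun p => h p.2 • q p.1) with hP
  have hPx : ∀ t, (fun x => P (x, t)) = (ball (0 : E) t).indicator (fun x => h t • q x) := by
    intro t; ext x
    simp [hP, indicator]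
  have hPt : ∀ x, (fun t => P (x, t)) = (Ioi ‖x‖).indicator (fun t => h t • q x) := by
    intro x; ext t
    simp [hP, indicator]
  have hqt : ∀ t, IntegrableOn q (ball (0 : E) t) μ := fun t =>
    (hq.continuousOn.integrableOn_compact (isCompact_closedBall 0 t)).mono_set
      ball_subset_closedBall
  have hmeas : AEStronglyMeasurable P (μ.prod (volume.restrict (Ioi 0))) :=
    ((hm.comp_snd).smul (hq.comp continuous_fst).aestronglyMeasurable).indicator
      (measurableSet_lt (by fun_prop) (by fun_prop))
  have hint : Integrable P (μ.prod (volume.restrict (Ioi 0))) := by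
    rw [integrable_prod_iff' hmeas]
    refine ⟨.of_forall fun t => ?_, ?_⟩
    · rw [hPx, integrable_indicator_iff measurableSet_ball]
      exact (hqt t).smul (h t)
    · refine (hh.const_mul (C * μ.real (ball 0 1))).mono
        hmeas.norm.prod_swap.integral_prod_right' ?_
      filter_upwards [ae_restrict_mem measurableSet_Ioi] with t ht
      have e1 : ∀ x, ‖P (x, t)‖ = (ball (0 : E) t).indicator (fun x => ‖h t • q x‖) x := by
        intro x
        rw [← norm_indicator_eq_indicator_norm, ← hPx]
      have hC0 : 0 ≤ C := (norm_nonneg _).trans (hC 0)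
      have hball : μ.real (ball (0 : E) t) = t ^ Module.finrank ℝ E * μ.real (ball 0 1) := by
        rw [measureReal_def, μ.addHaar_ball_of_pos _ ht, ENNReal.toReal_mul,
          ENNReal.toReal_ofReal (pow_nonneg ht.out.le _), measureReal_def]
      simp only [e1]
      rw [integral_indicator measurableSet_ball]
      calc ‖∫ x in ball (0 : E) t, ‖h t • q x‖ ∂μ‖
          ≤ (|h t| * C) * μ.real (ball (0 : E) t) := by
            refine norm_setIntegral_le_of_norm_le_const measure_ball_lt_top fun x _ => ?_
            rw [norm_norm, norm_smul, Real.norm_eq_abs]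
            gcongr
            exact hC x
        _ = ‖C * μ.real (ball (0 : E) 1) * (t ^ Module.finrank ℝ E * h t)‖ := by
            rw [hball, norm_mul, norm_mul, norm_mul, Real.norm_of_nonneg hC0,
              Real.norm_of_nonneg measureReal_nonneg,
              Real.norm_of_nonneg (pow_nonneg ht.out.le _), Real.norm_eq_abs]
            ring
  have ht : ∀ t, ∫ x, P (x, t) ∂μ = h t • ∫ x in ball (0 : E) t, q x ∂μ := by
    intro t
    rw [hPx, integral_indicator measurableSet_ball, integral_smul]
  have hx : ∀ x, ∫ t in Ioi 0, P (x, t) = (∫ t in Ioi ‖x‖, h t) • q x := by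
    intro x
    rw [hPt, setIntegral_indicator measurableSet_Ioi,
      inter_eq_right.2 (Ioi_subset_Ioi (norm_nonneg x)), integral_smul_const]
  constructor
  · have := hint.integral_prod_right
    simpa only [IntegrableOn, ht] using this
  · have := integral_integral_swap (f := fun x t => P (x, t)) hint
    simpa only [ht, hx] using this

variable [Nontrivial E]

/-- Integration in polar coordinates. -/
theorem integral_eq_integral_Ioi_sphere {f : E → F} (hf : Integrable f μ) :
    IntegrableOn (fun t : ℝ => t ^ (Module.finrank ℝ E - 1) •
      ∫ ω : sphere (0 : E) 1, f (t • (ω : E)) ∂μ.toSphere) (Ioi 0) ∧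
    ∫ x, f x ∂μ = ∫ t in Ioi (0 : ℝ), t ^ (Module.finrank ℝ E - 1) •
      ∫ ω : sphere (0 : E) 1, f (t • (ω : E)) ∂μ.toSphere := by
  set d := Module.finrank ℝ E - 1
  set G : sphere (0 : E) 1 × Ioi (0 : ℝ) → F := fun p => f ((p.2 : ℝ) • (p.1 : E)) with hG
  have hcomp : ∀ x : ({0}ᶜ : Set E), G (homeomorphUnitSphereProd E x) = f x := by
    intro x
    have hx : ‖(x : E)‖ ≠ 0 := norm_ne_zero_iff.2 x.2
    simp [hG, smul_smul, hx]
  have hmp := μ.measurePreserving_homeomorphUnitSphereProd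
  have hemb := (homeomorphUnitSphereProd E).measurableEmbedding
  have hGint : Integrable G (μ.toSphere.prod (Measure.volumeIoiPow d)) := by
    rw [← hmp.integrable_comp_emb hemb]
    have : G ∘ homeomorphUnitSphereProd E = f ∘ Subtype.val := funext hcomp
    rw [this, ← integrableOn_iff_comap_subtypeVal (measurableSet_singleton _).compl]
    exact hf.integrableOn
  have hdens : Measurable fun r : Ioi (0 : ℝ) => Real.toNNReal ((r : ℝ) ^ d) :=
    (measurable_subtype_coe.pow_const _).real_toNNReal
  have hcoe : ∀ r : Ioi (0 : ℝ), ((Real.toNNReal ((r : ℝ) ^ d) : NNReal) : ℝ) = (r : ℝ) ^ d :=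
    fun r => Real.coe_toNNReal _ (pow_nonneg r.2.out.le _)
  constructor
  · have h1 := hGint.integral_prod_right
    rw [Measure.volumeIoiPow] at h1
    simp only [ENNReal.ofReal] at h1
    rw [integrable_withDensity_iff_integrable_smul hdens] at h1
    rw [integrableOn_iff_comap_subtypeVal measurableSet_Ioi]
    refine h1.congr (.of_forall fun r => ?_)
    simp only [NNReal.smul_def, hcoe, hG, Function.comp]
  · calc ∫ x, f x ∂μ = ∫ x : ({0}ᶜ : Set E), f x ∂(μ.comap (↑)) := by
          rw [integral_subtype_comap (measurableSet_singleton _).compl f,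
            restrict_compl_singleton]
      _ = ∫ p, G p ∂(μ.toSphere.prod (Measure.volumeIoiPow d)) := by
          rw [← hmp.integral_comp hemb]
          exact integral_congr_ae (.of_forall fun x => (hcomp x).symm)
      _ = ∫ r, ∫ ω, G (ω, r) ∂μ.toSphere ∂(Measure.volumeIoiPow d) := integral_prod_symm _ hGint
      _ = _ := by
          rw [Measure.volumeIoiPow]
          simp only [ENNReal.ofReal]
          rw [integral_withDensity_eq_integral_smul hdens]
          simp only [NNReal.smul_def, hcoe, hG]
          exact integral_subtype_comap measurableSet_Ioi fun t : ℝ => t ^ d •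
            ∫ ω : sphere (0 : E) 1, f (t • (ω : E)) ∂μ.toSphere

/-- A product of a radial function and a function of at most linear growth is integrable. -/
theorem integrable_radial_smul {h : ℝ → ℝ} {k : E → F} {C : ℝ}
    (hh : IntegrableOn (fun t : ℝ => t ^ Module.finrank ℝ E * h t) (Ioi 0))
    (hk : AEStronglyMeasurable k μ) (hC : ∀ x, ‖k x‖ ≤ C * ‖x‖) :
    Integrable (fun x => h ‖x‖ • k x) μ := by
  have hpos : 0 < Module.finrank ℝ E := Module.finrank_pos
  have h1 : Integrable (fun x : E => ‖x‖ * h ‖x‖) μ := by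
    refine (integrable_fun_norm_addHaar μ (f := fun t => t * h t)).2
      (hh.congr_fun ?_ measurableSet_Ioi)
    intro t _
    simp only [smul_eq_mul, ← mul_assoc, ← pow_succ, Nat.sub_add_cancel hpos]
  have hm : AEStronglyMeasurable (fun x : E => h ‖x‖) μ := by
    have h2 : AEStronglyMeasurable (fun x : E => ‖x‖⁻¹ * (‖x‖ * h ‖x‖)) μ :=
      (measurable_norm.inv.aestronglyMeasurable).mul h1.aestronglyMeasurable
    refine h2.congr ?_
    filter_upwards [Measure.ae_ne μ (0 : E)] with x hx
    rw [inv_mul_cancel_left₀ (norm_ne_zero_iff.2 hx)]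
  refine (h1.const_mul C).mono (hm.smul hk) (.of_forall fun x => ?_)
  rw [norm_smul, norm_mul, norm_mul, norm_norm]
  calc ‖h ‖x‖‖ * ‖k x‖ ≤ ‖h ‖x‖‖ * (C * ‖x‖) := by gcongr; exact hC x
    _ ≤ ‖h ‖x‖‖ * (‖C‖ * ‖x‖) := by gcongr; exact Real.le_norm_self C
    _ = _ := by ring

/-- Integrating against a radial function, in polar coordinates. -/
theorem integral_radial_smul {h : ℝ → ℝ} {k : E → F} {C : ℝ}
    (hh : IntegrableOn (fun t : ℝ => t ^ Module.finrank ℝ E * h t) (Ioi 0))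
    (hk : AEStronglyMeasurable k μ) (hC : ∀ x, ‖k x‖ ≤ C * ‖x‖) :
    IntegrableOn (fun t : ℝ => h t • t ^ (Module.finrank ℝ E - 1) •
      ∫ ω : sphere (0 : E) 1, k (t • (ω : E)) ∂μ.toSphere) (Ioi 0) ∧
    ∫ x, h ‖x‖ • k x ∂μ = ∫ t in Ioi (0 : ℝ), h t • t ^ (Module.finrank ℝ E - 1) •
      ∫ ω : sphere (0 : E) 1, k (t • (ω : E)) ∂μ.toSphere := by
  have key := integral_eq_integral_Ioi_sphere μ (integrable_radial_smul μ hh hk hC)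
  have heq : EqOn (fun t : ℝ => t ^ (Module.finrank ℝ E - 1) •
        ∫ ω : sphere (0 : E) 1, h ‖t • (ω : E)‖ • k (t • (ω : E)) ∂μ.toSphere)
      (fun t : ℝ => h t • t ^ (Module.finrank ℝ E - 1) •
        ∫ ω : sphere (0 : E) 1, k (t • (ω : E)) ∂μ.toSphere) (Ioi 0) := by
    intro t ht
    have : ∀ ω : sphere (0 : E) 1, ‖t • (ω : E)‖ = t := fun ω => by
      simp [norm_smul, abs_of_pos ht.out]
    simp only [this, integral_smul]
    rw [smul_comm]
  exact ⟨key.1.congr_fun heq measurableSet_Ioi,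
    key.2.trans (setIntegral_congr_fun measurableSet_Ioi heq)⟩

end Polar

theorem norm_inv_mul_inner_le {E : Type*} [NormedAddCommGroup E] [InnerProductSpace ℝ E]
    (x v : E) : ‖‖x‖⁻¹ * ⟪x, v⟫_ℝ‖ ≤ ‖v‖ := by
  rcases eq_or_ne x 0 with rfl | hx
  · simp
  · rw [norm_mul, norm_inv, norm_norm, inv_mul_le_iff₀ (norm_pos_iff.2 hx)]
    exact norm_inner_le_norm x v

/-- The gradient of the tail integral of a test function on `(0, ∞)`, composed with the norm. -/
theorem hasFDerivAt_tail_norm {E : Type*} [NormedAddCommGroup E] [InnerProductSpace ℝ E]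
    {h : ℝ → ℝ} (hc : Continuous h) (hs : HasCompactSupport h)
    (hsub : tsupport h ⊆ Ioi 0) (x : E) :
    HasFDerivAt (fun x : E => ∫ t in Ioi ‖x‖, h t)
      (-(h ‖x‖ * ‖x‖⁻¹) • innerSL ℝ x) x := by
  have hint : Integrable h := hc.integrable_of_hasCompactSupport hs
  have htail : ∀ r : ℝ, ∫ t in Ioi r, h t = (∫ t in Ioi (0 : ℝ), h t) - ∫ t in (0 : ℝ)..r, h t := by
    intro r
    exact eq_sub_of_add_eq' (intervalIntegral.integral_interval_add_Ioi hint.integrableOn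
      hint.integrableOn)
  have hder : ∀ r : ℝ, HasDerivAt (fun r : ℝ => ∫ t in Ioi r, h t) (-h r) r := by
    intro r
    rw [funext htail]
    exact (intervalIntegral.integral_hasDerivAt_right (hc.intervalIntegrable _ _)
      hc.stronglyMeasurable.stronglyMeasurableAtFilter hc.continuousAt).const_sub _
  rcases eq_or_ne x 0 with rfl | hx
  · obtain ⟨δ, hδ, hball⟩ : ∃ δ > 0, ball (0 : ℝ) δ ⊆ (tsupport h)ᶜ :=
      Metric.isOpen_iff.1 (isClosed_tsupport h).isOpen_compl 0 fun h0 => lt_irrefl (0 : ℝ) (hsub h0)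
    have hzero : ∀ t, |t| < δ → h t = 0 := fun t ht =>
      image_eq_zero_of_notMem_tsupport (hball (by simpa using ht))
    have hconst : (fun x : E => ∫ t in Ioi ‖x‖, h t) =ᶠ[nhds 0]
        fun _ => ∫ t in Ioi (0 : ℝ), h t := by
      filter_upwards [ball_mem_nhds (0 : E) hδ] with y hy
      rw [htail ‖y‖, intervalIntegral.integral_zero_ae, sub_zero]
      refine .of_forall fun t ht => hzero t ?_
      rw [uIoc_of_le (norm_nonneg y)] at ht
      rw [abs_of_pos ht.1]
      exact ht.2.trans_lt (by simpa using hy)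
    simpa using (hasFDerivAt_const _ (0 : E)).congr_of_eventuallyEq hconst
  · have hn : HasFDerivAt (fun x : E => ‖x‖) (‖x‖⁻¹ • innerSL ℝ x) x := by
      have h2 := (hasStrictFDerivAt_norm_sq x).hasFDerivAt.sqrt
        (pow_ne_zero 2 (norm_ne_zero_iff.2 hx))
      simp only [Real.sqrt_sq (norm_nonneg _)] at h2
      convert h2 using 1
      ext y
      simp
      field_simp
    rw [neg_mul_eq_neg_mul, mul_smul]
    exact (hder ‖x‖).comp_hasFDerivAt x hn

section IntegrationByParts

variable {E F : Type*} [NormedAddCommGroup E] [InnerProductSpace ℝ E] [FiniteDimensional ℝ E]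
  [MeasurableSpace E] [BorelSpace E] [NormedAddCommGroup F] [NormedSpace ℝ F]
  (μ : Measure E) [μ.IsAddHaarMeasure]

/-- Integration by parts for the tail integral of a test function of the radius. -/
theorem integral_radial_ibp_of_test {h : ℝ → ℝ} (hc : Continuous h) (hs : HasCompactSupport h)
    (hsub : tsupport h ⊆ Ioi 0) {g : E → F} (hg : ContDiff ℝ 1 g) (v : E) :
    ∫ x, h ‖x‖ • (‖x‖⁻¹ * ⟪x, v⟫_ℝ) • g x ∂μ =
      ∫ x, (∫ t in Ioi ‖x‖, h t) • fderiv ℝ g x v ∂μ := by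
  set f : E → ℝ := fun x => ∫ t in Ioi ‖x‖, h t with hf
  have hfd := fun x : E => hasFDerivAt_tail_norm hc hs hsub x
  have hfc : Continuous f := continuous_iff_continuousAt.2 fun x => (hfd x).continuousAt
  obtain ⟨R, hR⟩ := hs.isCompact.isBounded.subset_closedBall 0
  have hR' : ∀ t, R < t → h t = 0 := by
    intro t ht
    refine image_eq_zero_of_notMem_tsupport fun hmem => ?_
    have h1 := hR hmem
    simp only [mem_closedBall, dist_zero_right, Real.norm_eq_abs] at h1
    exact absurd ((le_abs_self t).trans h1) ht.not_ge
  have hfs : HasCompactSupport f := by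
    refine HasCompactSupport.intro (isCompact_closedBall (0 : E) R) fun x hx => ?_
    have hx' : R < ‖x‖ := by simpa using hx
    exact setIntegral_eq_zero_of_forall_eq_zero fun t ht => hR' t (hx'.trans ht)
  have hfderiv : ∀ x, fderiv ℝ f x v = -(h ‖x‖ * (‖x‖⁻¹ * ⟪x, v⟫_ℝ)) := by
    intro x
    rw [(hfd x).fderiv]
    simp
    ring
  have hgc : Continuous g := hg.continuous
  have hg'c : Continuous fun x => fderiv ℝ g x v :=
    (hg.continuous_fderiv one_ne_zero).clm_apply continuous_const
  have hkey := integral_smul_fderiv_eq_neg_fderiv_smul_of_integrable (μ := μ) (f := f) (g := g)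
    (v := v) ?_ ?_ ?_ (fun x _ => (hfd x).differentiableAt)
    (fun x _ => (hg.differentiable one_ne_zero).differentiableAt)
  · rw [hkey, ← integral_neg]
    refine integral_congr_ae (.of_forall fun x => ?_)
    simp only [hfderiv, neg_smul, neg_neg, mul_smul]
  · have hb : Integrable (fun x : E => h ‖x‖ • g x) μ := by
      refine ((hc.comp continuous_norm).smul hgc).integrable_of_hasCompactSupport ?_
      refine HasCompactSupport.intro (isCompact_closedBall (0 : E) R) fun x hx => ?_
      simp [hR' ‖x‖ (by simpa using hx)]
    refine (hb.norm.const_mul ‖v‖).mono' ?_ (.of_forall fun x => ?_)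
    · simp only [hfderiv]
      refine AEStronglyMeasurable.smul (Measurable.aestronglyMeasurable ?_)
        hgc.aestronglyMeasurable
      have := hc.measurable
      fun_prop
    · rw [hfderiv, norm_smul, norm_neg, norm_mul, norm_smul]
      have : ‖‖x‖⁻¹ * ⟪x, v⟫_ℝ‖ ≤ ‖v‖ := norm_inv_mul_inner_le x v
      calc ‖h ‖x‖‖ * ‖‖x‖⁻¹ * ⟪x, v⟫_ℝ‖ * ‖g x‖ ≤ ‖h ‖x‖‖ * ‖v‖ * ‖g x‖ := by gcongr
        _ = _ := by ring
  · exact (hfc.smul hg'c).integrable_of_hasCompactSupport hfs.smul_right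
  · exact (hfc.smul hgc).integrable_of_hasCompactSupport hfs.smul_right

/-- Integration by parts for the tail integral of a function of the radius. -/
theorem integral_radial_ibp [Nontrivial E] [CompleteSpace F] {h : ℝ → ℝ} {g : E → F} {C : ℝ} {v : E}
    (hh : IntegrableOn (fun t : ℝ => t ^ Module.finrank ℝ E * h t) (Ioi 0))
    (hg : ContDiff ℝ 1 g) (hgC : ∀ x, ‖g x‖ ≤ C * ‖x‖) (hgC' : ∀ x, ‖fderiv ℝ g x v‖ ≤ C) :
    ∫ x, h ‖x‖ • (‖x‖⁻¹ * ⟪x, v⟫_ℝ) • g x ∂μ =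
      ∫ x, (∫ t in Ioi ‖x‖, h t) • fderiv ℝ g x v ∂μ := by
  set k : E → F := fun x => (‖x‖⁻¹ * ⟪x, v⟫_ℝ) • g x with hk
  have hkm : AEStronglyMeasurable k μ :=
    AEStronglyMeasurable.smul (Measurable.aestronglyMeasurable (by fun_prop))
      hg.continuous.aestronglyMeasurable
  have hkC : ∀ x, ‖k x‖ ≤ (‖v‖ * C) * ‖x‖ := by
    intro x
    rw [hk, norm_smul, mul_assoc]
    exact mul_le_mul (norm_inv_mul_inner_le x v) (hgC x) (norm_nonneg _) (norm_nonneg _)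
  have hqc : Continuous fun x => fderiv ℝ g x v :=
    (hg.continuous_fderiv one_ne_zero).clm_apply continuous_const
  set S : ℝ → F := fun t => t ^ (Module.finrank ℝ E - 1) •
    ∫ ω : sphere (0 : E) 1, k (t • (ω : E)) ∂μ.toSphere
  set B : ℝ → F := fun t => ∫ x in ball (0 : E) t, fderiv ℝ g x v ∂μ
  have hS : ∀ {h : ℝ → ℝ}, IntegrableOn (fun t : ℝ => t ^ Module.finrank ℝ E * h t) (Ioi 0) →
      IntegrableOn (fun t => h t • S t) (Ioi 0) ∧
        ∫ x, h ‖x‖ • k x ∂μ = ∫ t in Ioi (0 : ℝ), h t • S t :=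
    fun hh => integral_radial_smul μ hh hkm hkC
  have hB : ∀ {h : ℝ → ℝ}, IntegrableOn (fun t : ℝ => t ^ Module.finrank ℝ E * h t) (Ioi 0) →
      IntegrableOn (fun t => h t • B t) (Ioi 0) ∧
        ∫ x, (∫ t in Ioi ‖x‖, h t) • fderiv ℝ g x v ∂μ = ∫ t in Ioi (0 : ℝ), h t • B t :=
    fun hh => integral_tail_smul μ hh hqc hgC'
  have hloc : LocallyIntegrableOn (fun t => S t - B t) (Ioi 0) := by
    rw [locallyIntegrableOn_iff isOpen_Ioi.isLocallyClosed]
    intro K hK0 hK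
    have hind : IntegrableOn (fun t : ℝ => t ^ Module.finrank ℝ E * K.indicator 1 t) (Ioi 0) := by
      have : (fun t : ℝ => t ^ Module.finrank ℝ E * K.indicator 1 t) =
          K.indicator fun t => t ^ Module.finrank ℝ E := by
        ext t
        by_cases ht : t ∈ K <;> simp [ht]
      rw [this]
      exact (((continuous_pow _).continuousOn.integrableOn_compact hK).integrable_indicator
        hK.measurableSet).integrableOn
    refine (((hS hind).1.sub (hB hind).1).mono_set hK0).congr_fun (fun t ht => ?_)
      hK.measurableSet
    simp [ht]
  have hae : ∀ᵐ t, t ∈ Ioi (0 : ℝ) → S t - B t = 0 := by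
    refine isOpen_Ioi.ae_eq_zero_of_integral_contDiff_smul_eq_zero hloc fun φ hφ hφs hφ0 => ?_
    have hφi : IntegrableOn (fun t : ℝ => t ^ Module.finrank ℝ E * φ t) (Ioi 0) :=
      (((continuous_pow _).mul hφ.continuous).integrable_of_hasCompactSupport
        hφs.mul_left).integrableOn
    rw [← setIntegral_eq_integral_of_forall_compl_eq_zero (s := Ioi 0)]
    · simp only [smul_sub]
      rw [integral_sub (hS hφi).1 (hB hφi).1, ← (hS hφi).2, ← (hB hφi).2, sub_eq_zero]
      exact integral_radial_ibp_of_test μ hφ.continuous hφs hφ0 hg v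
    · intro t ht
      rw [image_eq_zero_of_notMem_tsupport fun hmem => ht (hφ0 hmem), zero_smul]
  rw [(hS hh).2, (hB hh).2]
  refine setIntegral_congr_ae measurableSet_Ioi ?_
  filter_upwards [hae] with t ht ht0
  rw [sub_eq_zero.1 (ht ht0)]

end IntegrationByParts

section Phase

variable {E : Type*} [NormedAddCommGroup E] [InnerProductSpace ℝ E]

/-- The Fourier phase `e^{-2πi x·ξ}`. -/
def fourierPhase (ξ x : E) : ℂ :=
  Complex.exp (-(2 * Real.pi * (⟪x, ξ⟫_ℝ : ℝ) * Complex.I))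

theorem fourierPhase_eq (ξ x : E) :
    fourierPhase ξ x = Complex.exp (Complex.I * ((-(2 * Real.pi * ⟪x, ξ⟫_ℝ) : ℝ) : ℂ)) := by
  rw [fourierPhase]
  push_cast
  ring_nf

theorem norm_fourierPhase (ξ x : E) : ‖fourierPhase ξ x‖ = 1 := by
  rw [fourierPhase_eq, mul_comm, Complex.norm_exp_ofReal_mul_I]

theorem fourierPhase_add (ξ x y : E) :
    fourierPhase ξ (x + y) = fourierPhase ξ x * fourierPhase ξ y := by
  simp only [fourierPhase, ← Complex.exp_add, inner_add_left]
  push_cast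
  ring_nf

theorem contDiff_fourierPhase (ξ : E) : ContDiff ℝ 1 (fourierPhase ξ) := by
  unfold fourierPhase
  have h : ContDiff ℝ 1 fun x : E => ((⟪x, ξ⟫_ℝ : ℝ) : ℂ) :=
    Complex.ofRealCLM.contDiff.comp (contDiff_id.inner ℝ contDiff_const)
  exact ((contDiff_const.mul h).mul contDiff_const).neg.cexp

theorem continuous_fourierPhase (ξ : E) : Continuous (fourierPhase ξ) :=
  (contDiff_fourierPhase ξ).continuous

theorem norm_one_sub_fourierPhase_le (ξ x : E) :
    ‖1 - fourierPhase ξ x‖ ≤ 2 * Real.pi * ‖ξ‖ * ‖x‖ := by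
  rw [norm_sub_rev, fourierPhase_eq]
  refine Real.norm_exp_I_mul_ofReal_sub_one_le.trans ?_
  rw [norm_neg, norm_mul, Real.norm_of_nonneg Real.two_pi_pos.le, mul_assoc _ ‖ξ‖, mul_comm ‖ξ‖]
  gcongr
  exact norm_inner_le_norm x ξ

theorem fderiv_one_sub_fourierPhase (ξ x v : E) :
    fderiv ℝ (fun x => 1 - fourierPhase ξ x) x v =
      2 * Real.pi * Complex.I * (⟪v, ξ⟫_ℝ : ℝ) * fourierPhase ξ x := by
  have h : HasFDerivAt (fun x : E => ((⟪x, ξ⟫_ℝ : ℝ) : ℂ))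
      (Complex.ofRealCLM.comp (innerSL ℝ ξ)) x := by
    have h1 := (Complex.ofRealCLM.comp (innerSL ℝ ξ)).hasFDerivAt (x := x)
    refine h1.congr_of_eventuallyEq (.of_forall fun y => ?_)
    simp [real_inner_comm]
  have h2 := ((((h.const_mul (2 * (Real.pi : ℂ))).mul_const Complex.I).neg).cexp).const_sub 1
  have h3 : fderiv ℝ (fun x => 1 - fourierPhase ξ x) x = _ := h2.fderiv
  rw [h3]
  simp [fourierPhase, real_inner_comm]
  ring

end Phase

section Symbol

variable {E : Type*} [NormedAddCommGroup E] [InnerProductSpace ℝ E]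
  [MeasurableSpace E] [BorelSpace E] (μ : Measure E) [μ.IsAddHaarMeasure]

/-- The Fourier transform of a difference of translates. -/
theorem integral_sub_translate_mul_fourierPhase {u : E → ℝ} (hu : Continuous u)
    (hus : HasCompactSupport u) (ξ z : E) :
    ∫ x, ((u x - u (x - z) : ℝ) : ℂ) * fourierPhase ξ x ∂μ =
      (1 - fourierPhase ξ z) * ∫ x, (u x : ℂ) * fourierPhase ξ x ∂μ := by
  have hint : Integrable (fun x => (u x : ℂ) * fourierPhase ξ x) μ :=
    ((Complex.continuous_ofReal.comp hu).mul
      (continuous_fourierPhase ξ)).integrable_of_hasCompactSupport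
      (hus.comp_left Complex.ofReal_zero).mul_right
  have hshift : ∀ x, (u (x - z) : ℂ) * fourierPhase ξ x =
      fourierPhase ξ z * ((u (x - z) : ℂ) * fourierPhase ξ (x - z)) := by
    intro x
    conv_lhs => rw [← sub_add_cancel x z, fourierPhase_add]
    rw [sub_add_cancel]
    ring
  simp only [Complex.ofReal_sub, sub_mul]
  simp only [hshift]
  rw [integral_sub hint ((hint.comp_sub_right z).const_mul _), integral_const_mul,
    integral_sub_right_eq_self (fun x => (u x : ℂ) * fourierPhase ξ x) z, one_mul]

variable [FiniteDimensional ℝ E]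

/-- The difference quotient integrand is integrable jointly in the point and the increment. -/
theorem integrable_translate_kernel {u ρ k : E → ℝ} {K : NNReal} (hu : LipschitzWith K u)
    (hus : HasCompactSupport u) (hρ : Integrable ρ μ) (hρs : HasCompactSupport ρ)
    (hkm : AEStronglyMeasurable k μ) (hk : ∀ z, ‖z‖ * |k z| ≤ |ρ z|)
    {e : E → ℂ} (hec : Continuous e) (he : ∀ x, ‖e x‖ ≤ 1) :
    Integrable (Function.uncurry fun x z => (((u x - u (x - z)) * k z : ℝ) : ℂ) * e x)
      (μ.prod μ) := by
  obtain ⟨R, hR⟩ := hus.isCompact.isBounded.subset_closedBall 0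
  obtain ⟨R', hR'⟩ := hρs.isCompact.isBounded.subset_closedBall 0
  have huc := hu.continuous
  have hdom : Integrable (fun p : E × E =>
      (closedBall (0 : E) (max R 0 + R')).indicator (fun _ => (K : ℝ)) p.1 * |ρ p.2|)
      (μ.prod μ) := by
    refine Integrable.mul_prod (IntegrableOn.integrable_indicator ?_ measurableSet_closedBall) hρ.abs
    exact continuousOn_const.integrableOn_compact (isCompact_closedBall _ _)
  refine hdom.mono' ?_ (.of_forall fun ⟨x, z⟩ => ?_)
  · refine AEStronglyMeasurable.mul ?_ (hec.comp continuous_fst).aestronglyMeasurable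
    refine Complex.continuous_ofReal.comp_aestronglyMeasurable (AEStronglyMeasurable.mul ?_ ?_)
    · exact Continuous.aestronglyMeasurable (by fun_prop)
    · exact hkm.comp_snd
  · simp only [Function.uncurry, norm_mul, Complex.norm_real, Real.norm_eq_abs]
    have hlip : |u x - u (x - z)| ≤ K * ‖z‖ := by
      simpa [Real.dist_eq, dist_eq_norm] using hu.dist_le_mul x (x - z)
    have hmain : |u x - u (x - z)| * |k z| ≤ K * |ρ z| :=
      calc |u x - u (x - z)| * |k z| ≤ K * ‖z‖ * |k z| := by gcongr
        _ = K * (‖z‖ * |k z|) := by ring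
        _ ≤ K * |ρ z| := by gcongr; exact hk z
    have hle : |u x - u (x - z)| * |k z| * ‖e x‖ ≤ |u x - u (x - z)| * |k z| :=
      mul_le_of_le_one_right (by positivity) (he x)
    by_cases hx : x ∈ closedBall (0 : E) (max R 0 + R')
    · rw [indicator_of_mem hx]
      exact hle.trans hmain
    · rw [indicator_of_notMem hx, zero_mul]
      refine hle.trans ?_
      by_cases hz : ρ z = 0
      · simpa [hz] using hmain
      · have hz' : ‖z‖ ≤ R' := by simpa using hR' (subset_tsupport ρ hz)
        have hx' : max R 0 + R' < ‖x‖ := by simpa using hx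
        have hzero : ∀ y, R < ‖y‖ → u y = 0 := fun y hy =>
          image_eq_zero_of_notMem_tsupport fun hmem => hy.not_ge (by simpa using hR hmem)
        have h1 : u x = 0 := hzero x (by
          have := le_max_left R 0
          have := norm_nonneg z
          linarith)
        have h2 : u (x - z) = 0 := hzero _ (by
          have := le_max_left R 0
          have := norm_sub_norm_le x z
          linarith)
        simp [h1, h2]

/-- The Fourier symbol of the convolution-type difference operator with kernel `k`. -/
theorem integral_difference_mul_fourierPhase {u ρ k : E → ℝ} {K : NNReal}
    (hu : LipschitzWith K u) (hus : HasCompactSupport u) (hρ : Integrable ρ μ)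
    (hρs : HasCompactSupport ρ) (hkm : AEStronglyMeasurable k μ)
    (hk : ∀ z, ‖z‖ * |k z| ≤ |ρ z|) (ξ : E) :
    ∫ x, ((∫ z, (u x - u (x - z)) * k z ∂μ : ℝ) : ℂ) * fourierPhase ξ x ∂μ =
      (∫ z, k z • (1 - fourierPhase ξ z) ∂μ) * ∫ x, (u x : ℂ) * fourierPhase ξ x ∂μ := by
  have hint := integrable_translate_kernel μ hu hus hρ hρs hkm hk (continuous_fourierPhase ξ)
    fun x => (norm_fourierPhase ξ x).le
  calc _ = ∫ x, ∫ z, (((u x - u (x - z)) * k z : ℝ) : ℂ) * fourierPhase ξ x ∂μ ∂μ := by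
        simp only [integral_mul_const, integral_complex_ofReal]
    _ = ∫ z, ∫ x, (((u x - u (x - z)) * k z : ℝ) : ℂ) * fourierPhase ξ x ∂μ ∂μ :=
        integral_integral_swap hint
    _ = ∫ z, (k z • (1 - fourierPhase ξ z)) * ∫ x, (u x : ℂ) * fourierPhase ξ x ∂μ ∂μ := by
        refine integral_congr_ae (.of_forall fun z => ?_)
        simp only
        rw [smul_mul_assoc, ← integral_sub_translate_mul_fourierPhase μ hu.continuous hus ξ z,
          ← integral_smul]
        refine integral_congr_ae (.of_forall fun x => ?_)
        simp only [Complex.real_smul]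
        push_cast
        ring
    _ = _ := integral_mul_const _ _

end Symbol

/-- A component of the nonlocal gradient as an integral over increments. -/
theorem nlGradS_apply {ρ u : Eu n → ℝ} {K : NNReal} (hu : LipschitzWith K u)
    (hρ : Integrable ρ) (x : Eu n) (i : Fin n) :
    (nlGradS ρ u x) i = ∫ z, (u x - u (x - z)) * (ρ z / ‖z‖ ^ 2 * z i) := by
  set Φ : Eu n → Eu n := fun z => ((u x - u (x - z)) * ρ z / ‖z‖ ^ 2) • z with hΦ
  have huc := hu.continuous
  have hint : Integrable Φ := by
    refine (hρ.norm.const_mul (K : ℝ)).mono' ?_ (.of_forall fun z => ?_)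
    · simp only [hΦ, div_eq_mul_inv]
      refine AEStronglyMeasurable.smul (f := fun z => (u x - u (x - z)) * ρ z * (‖z‖ ^ 2)⁻¹) ?_
        continuous_id.aestronglyMeasurable
      refine AEStronglyMeasurable.mul (AEStronglyMeasurable.mul ?_ hρ.aestronglyMeasurable) ?_
      · exact Continuous.aestronglyMeasurable (by fun_prop)
      · exact Measurable.aestronglyMeasurable (by fun_prop)
    · rcases eq_or_ne z 0 with rfl | hz
      · simp only [hΦ, smul_zero, norm_zero]
        positivity
      · have hz' : 0 < ‖z‖ := norm_pos_iff.2 hz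
        have hlip : ‖u x - u (x - z)‖ ≤ K * ‖z‖ := by
          simpa [dist_eq_norm] using hu.dist_le_mul x (x - z)
        rw [hΦ, norm_smul, norm_div, norm_mul, norm_pow, norm_norm]
        calc ‖u x - u (x - z)‖ * ‖ρ z‖ / ‖z‖ ^ 2 * ‖z‖
            ≤ K * ‖z‖ * ‖ρ z‖ / ‖z‖ ^ 2 * ‖z‖ := by gcongr
          _ = K * ‖ρ z‖ := by field_simp
  have h1 : nlGradS ρ u x = ∫ z, Φ z := by
    rw [nlGradS, ← integral_sub_left_eq_self Φ volume x]
    simp only [hΦ, sub_sub_cancel]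
  have h2 := (EuclideanSpace.proj i : Eu n →L[ℝ] ℝ).integral_comp_comm hint
  rw [h1]
  refine Eq.trans h2.symm (integral_congr_ae (.of_forall fun z => ?_))
  simp [hΦ]
  ring

/-- The Fourier symbol of the kernel `ρ(z) z_i / |z|²` in terms of the potential `Q_ρ`. -/
theorem integral_kernel_smul_one_sub_fourierPhase (hn : 0 < n) {ρ : Eu n → ℝ} {ρb : ℝ → ℝ}
    (hrad : ∀ x : Eu n, x ≠ 0 → ρ x = ρb ‖x‖) (hρ : Integrable ρ) (ξ : Eu n) (i : Fin n) :
    ∫ z, (ρ z / ‖z‖ ^ 2 * z i) • (1 - fourierPhase ξ z) =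
      2 * Real.pi * Complex.I * (ξ i : ℂ) * ∫ x, (Qker n ρb x : ℂ) * fourierPhase ξ x := by
  have : Nonempty (Fin n) := ⟨⟨0, hn⟩⟩
  have hdim : Module.finrank ℝ (Eu n) = n := by simp
  have hrad' : Integrable (fun x : Eu n => ρb ‖x‖) := by
    refine hρ.congr ?_
    filter_upwards [Measure.ae_ne volume (0 : Eu n)] with x hx
    exact hrad x hx
  have hh : IntegrableOn (fun t : ℝ => t ^ Module.finrank ℝ (Eu n) * (ρb t / t)) (Ioi 0) := by
    refine ((integrable_fun_norm_addHaar volume).1 hrad').congr_fun (fun t ht => ?_)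
      measurableSet_Ioi
    have ht' : t ≠ 0 := ht.out.ne'
    obtain ⟨m, rfl⟩ := Nat.exists_eq_add_of_lt hn
    simp only [hdim, smul_eq_mul, Nat.zero_add, Nat.add_sub_cancel, pow_succ]
    field_simp
  set v : Eu n := EuclideanSpace.single i 1
  have hfd := fun x => fderiv_one_sub_fourierPhase ξ x v
  have hv : ⟪v, ξ⟫_ℝ = ξ i := by simp [v, EuclideanSpace.inner_single_left]
  have key := integral_radial_ibp (volume : Measure (Eu n)) (h := fun t => ρb t / t)
    (g := fun x => 1 - fourierPhase ξ x) (C := 2 * Real.pi * ‖ξ‖) (v := v) hh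
    (contDiff_const.sub (contDiff_fourierPhase ξ)) (norm_one_sub_fourierPhase_le ξ) fun x => by
      rw [hfd, norm_mul, norm_fourierPhase, hv]
      simp only [norm_mul, Complex.norm_I, Complex.norm_real, Complex.norm_ofNat, mul_one,
        Real.norm_of_nonneg Real.pi_pos.le]
      gcongr
      exact PiLp.norm_apply_le ξ i
  have hl : ∫ z, (ρ z / ‖z‖ ^ 2 * z i) • (1 - fourierPhase ξ z) =
      ∫ x : Eu n, (ρb ‖x‖ / ‖x‖) • (‖x‖⁻¹ * ⟪x, v⟫_ℝ) • (1 - fourierPhase ξ x) := by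
    refine integral_congr_ae ?_
    filter_upwards [Measure.ae_ne volume (0 : Eu n)] with x hx
    have hxv : ⟪x, v⟫_ℝ = x i := by simp [v, EuclideanSpace.inner_single_right]
    rw [hrad x hx, hxv, smul_smul]
    congr 1
    have := norm_ne_zero_iff.2 hx
    field_simp
  rw [hl, key, ← integral_const_mul]
  refine integral_congr_ae (.of_forall fun x => ?_)
  simp only [hfd, hv, Complex.real_smul, Qker]
  ring

/-- the Fourier symbol of the nonlocal gradient. -/
theorem stmt16 (hn : 0 < n) (ρ : Eu n → ℝ) (ρb : ℝ → ℝ) (ε : ℝ)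
    (h0 : IsKernelH0 n ρ ρb ε) (hsupp : HasCompactSupport ρ)
    (u : Eu n → ℝ) (hu : ContDiff ℝ (⊤ : ℕ∞) u) (hus : HasCompactSupport u)
    (ξ : Eu n) (i : Fin n) :
    fInt (fun x => ((nlGradS ρ u x) i : ℂ)) ξ =
      2 * Real.pi * Complex.I * (ξ i : ℂ) * fInt (fun x => (Qker n ρb x : ℂ)) ξ *
        fInt (fun x => (u x : ℂ)) ξ := by
  obtain ⟨-, hrad, hloc, -⟩ := h0
  have hρ : Integrable ρ :=
    (integrableOn_iff_integrable_of_support_subset (subset_tsupport ρ)).1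
      (hloc.integrableOn_isCompact hsupp)
  obtain ⟨K, hK⟩ := hu.lipschitzWith_of_hasCompactSupport hus (by simp)
  have hkm : AEStronglyMeasurable (fun z : Eu n => ρ z / ‖z‖ ^ 2 * z i) := by
    simp only [div_eq_mul_inv, mul_assoc]
    exact hρ.aestronglyMeasurable.mul (Measurable.aestronglyMeasurable (by fun_prop))
  have hk : ∀ z : Eu n, ‖z‖ * |ρ z / ‖z‖ ^ 2 * z i| ≤ |ρ z| := by
    intro z
    rcases eq_or_ne z 0 with rfl | hz
    · simp
    · have hz' : 0 < ‖z‖ := norm_pos_iff.2 hz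
      have hzi : |z i| ≤ ‖z‖ := PiLp.norm_apply_le z i
      rw [abs_mul, abs_div, abs_pow, abs_norm]
      calc ‖z‖ * (|ρ z| / ‖z‖ ^ 2 * |z i|) ≤ ‖z‖ * (|ρ z| / ‖z‖ ^ 2 * ‖z‖) := by gcongr
        _ = |ρ z| := by field_simp
  have key := integral_difference_mul_fourierPhase volume hK hus hρ hsupp hkm hk ξ
  simp only [← nlGradS_apply n hK hρ] at key
  rw [integral_kernel_smul_one_sub_fourierPhase n hn hrad hρ] at key
  exact key
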